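/- arXiv:1410.5034 — 7 statements merged into one kernel-verified Lean document; each statement's English description precedes it below -/
import Mathlib

section
/- Let (Λ,Π,⊥) be a realizability lattice equipped with a push map. For all P, Q, R ∈ P_⊥(Π): if Q ⇒_⊥ R ⊆ P, then R ⊆ P ∘_⊥ Q. In particular, P ⊆ (Q ⇒_⊥ P) ∘_⊥ Q for all P, Q ∈ P_⊥(Π). (Half adjunction property.) -/
variable {Lam Stk : Type*}

/-- `L^⊥`. -/
def pol (perp : Lam → Stk → Prop) (L : Set Lam) : Set Stk := {π | ∀ t ∈ L, perp t π}

/-- `^⊥P`. -/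
def lpol (perp : Lam → Stk → Prop) (P : Set Stk) : Set Lam := {t | ∀ π ∈ P, perp t π}

/-- `L ⇝ P`. -/
def leadsto (push : Lam → Stk → Stk) (L : Set Lam) (P : Set Stk) : Set Stk :=
  {π | ∀ t ∈ L, push t π ∈ P}

/-- `L · P`. -/
def pushSet (push : Lam → Stk → Stk) (L : Set Lam) (P : Set Stk) : Set Stk :=
  {x | ∃ t ∈ L, ∃ π ∈ P, x = push t π}

/-- `P ∘_⊥ Q = (^⊥(^⊥Q ⇝ P))^⊥`. -/
def circbot (perp : Lam → Stk → Prop) (push : Lam → Stk → Stk) (P Q : Set Stk) : Set Stk :=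
  pol perp (lpol perp (leadsto push (lpol perp Q) P))

/-- `P ⇒_⊥ Q = (^⊥(^⊥P · Q))^⊥`. -/
def impbot (perp : Lam → Stk → Prop) (push : Lam → Stk → Stk) (P Q : Set Stk) : Set Stk :=
  pol perp (lpol perp (pushSet push (lpol perp P) Q))

/-- Every set of stacks is contained in its biorthogonal. -/
theorem subset_pol_lpol (perp : Lam → Stk → Prop) (P : Set Stk) :
    P ⊆ pol perp (lpol perp P) :=
  fun π hπ _ ht => ht π hπ

/-- Half of the adjunction holds for arbitrary sets of stacks, closed or not. -/
theorem subset_circbot_of_impbot_subset (perp : Lam → Stk → Prop) (push : Lam → Stk → Stk)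
    {P Q R : Set Stk} (h : impbot perp push Q R ⊆ P) : R ⊆ circbot perp push P Q :=
  fun π hπ => subset_pol_lpol perp _ fun t ht =>
    h (subset_pol_lpol perp _ ⟨t, ht, π, hπ, rfl⟩)

/-- Half adjunction property in a realizability lattice with a push map. -/
theorem half_adjunction (perp : Lam → Stk → Prop) (push : Lam → Stk → Stk) :
    (∀ P Q R : Set Stk,
      pol perp (lpol perp P) = P → pol perp (lpol perp Q) = Q →
      pol perp (lpol perp R) = R →
      impbot perp push Q R ⊆ P → R ⊆ circbot perp push P Q) ∧
    (∀ P Q : Set Stk,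
      pol perp (lpol perp P) = P → pol perp (lpol perp Q) = Q →
      P ⊆ circbot perp push (impbot perp push Q P) Q) := by
  exact ⟨fun _ _ _ _ _ _ h => subset_circbot_of_impbot_subset perp push h,
    fun _ _ _ _ => subset_circbot_of_impbot_subset perp push subset_rfl⟩
end

section
/- Let K be an abstract Krivine structure. For all P, Q ∈ P_⊥(Π): cc ⊥ (((P ⇒_⊥ Q) ⇒_⊥ P) ⇒_⊥ P), or equivalently cc ⊥ (((P ⇒ Q) ⇒ P) ⇒ P). (cc realizes Peirce's law.) -/
/-- An abstract Krivine structure (AKS). -/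
structure AKS (Lam Stk : Type*) where
  perp : Lam → Stk → Prop
  push : Lam → Stk → Stk
  app : Lam → Lam → Lam
  store : Stk → Lam
  QP : Set Lam
  K : Lam
  S : Lam
  cc : Lam
  K_mem : K ∈ QP
  S_mem : S ∈ QP
  cc_mem : cc ∈ QP
  QP_app : ∀ {t u}, t ∈ QP → u ∈ QP → app t u ∈ QP
  S1 : ∀ {t s π}, perp t (push s π) → perp (app t s) π
  S2 : ∀ {t π}, perp t π → ∀ s, perp K (push t (push s π))
  S3 : ∀ {t s u π}, perp (app (app t u) (app s u)) π → perp S (push t (push s (push u π)))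
  S4 : ∀ {t π}, perp t (push (store π) π) → perp cc (push t π)
  S5 : ∀ {t π}, perp t π → ∀ π', perp (store π) (push t π')

namespace AKS

variable {Lam Stk : Type*} (A : AKS Lam Stk)

/-- `L^⊥` for `L ⊆ Λ`. -/
def pol (L : Set Lam) : Set Stk := {π | ∀ t ∈ L, A.perp t π}

/-- `^⊥P` for `P ⊆ Π`. -/
def lpol (P : Set Stk) : Set Lam := {t | ∀ π ∈ P, A.perp t π}

/-- `P ∈ P_⊥(Π)`. -/
def stable (P : Set Stk) : Prop := A.pol (A.lpol P) = P

/-- `L ⇝ P`. -/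
def leadsto (L : Set Lam) (P : Set Stk) : Set Stk := {π | ∀ t ∈ L, A.push t π ∈ P}

/-- `L · P`. -/
def pushSet (L : Set Lam) (P : Set Stk) : Set Stk := {x | ∃ t ∈ L, ∃ π ∈ P, x = A.push t π}

/-- `P ∘_⊥ Q = (^⊥(^⊥Q ⇝ P))^⊥`. -/
def circbot (P Q : Set Stk) : Set Stk := A.pol (A.lpol (A.leadsto (A.lpol Q) P))

/-- `P ⇒ Q = ^⊥P · Q`. -/
def impA (P Q : Set Stk) : Set Stk := A.pushSet (A.lpol P) Q

/-- `P ⇒_⊥ Q = (^⊥(^⊥P · Q))^⊥`. -/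
def impbot (P Q : Set Stk) : Set Stk := A.pol (A.lpol (A.impA P Q))

/-- `P ◇ Q = ((^⊥P)(^⊥Q))^⊥`. -/
def diamond (P Q : Set Stk) : Set Stk :=
  A.pol {x | ∃ t ∈ A.lpol P, ∃ s ∈ A.lpol Q, x = A.app t s}

/-- `t ⊥ P` : `t` realizes `P`. -/
def perpS (t : Lam) (P : Set Stk) : Prop := ∀ π ∈ P, A.perp t π

end AKS

namespace AKS

variable {Lam Stk : Type*} (A : AKS Lam Stk)

theorem lpol_pol_lpol (P : Set Stk) : A.lpol (A.pol (A.lpol P)) = A.lpol P :=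
  Set.Subset.antisymm (fun _ ht π hπ => ht π fun _ hs => hs π hπ) fun t ht _ hπ => hπ t ht

theorem lpol_impbot (P Q : Set Stk) : A.lpol (A.impbot P Q) = A.lpol (A.impA P Q) :=
  A.lpol_pol_lpol _

theorem impA_impbot_left (P Q R : Set Stk) :
    A.impA (A.impbot P Q) R = A.impA (A.impA P Q) R := by
  rw [impA, lpol_impbot, ← impA]

theorem store_mem_lpol_impA {P : Set Stk} {π : Stk} (hπ : π ∈ P) (Q : Set Stk) :
    A.store π ∈ A.lpol (A.impA P Q) := by
  rintro _ ⟨t, ht, π', -, rfl⟩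
  exact A.S5 (ht π hπ) π'

theorem cc_mem_lpol_peirce (P Q : Set Stk) :
    A.cc ∈ A.lpol (A.impA (A.impA (A.impA P Q) P) P) := by
  rintro _ ⟨t, ht, π, hπ, rfl⟩
  exact A.S4 (ht _ ⟨A.store π, A.store_mem_lpol_impA hπ Q, π, hπ, rfl⟩)

end AKS

/-- `cc` realizes Peirce's law, in both the `⇒_⊥` and the `⇒` formulations. -/
theorem cc_realizes_peirce {Lam Stk : Type*} (A : AKS Lam Stk)
    (P Q : Set Stk) (hP : A.stable P) (hQ : A.stable Q) :
    A.perpS A.cc (A.impbot (A.impbot (A.impbot P Q) P) P) ∧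
    A.perpS A.cc (A.impA (A.impA (A.impA P Q) P) P) := by
  refine ⟨?_, A.cc_mem_lpol_peirce P Q⟩
  change A.cc ∈ A.lpol _
  rw [A.lpol_impbot, A.impA_impbot_left, A.impA_impbot_left]
  exact A.cc_mem_lpol_peirce P Q
end

section
/- Let K be an abstract Krivine structure and set E := S(K(SKK)). Then for all t, u ∈ Λ and π ∈ Π: if tu ⊥ π then Et ⊥ u·π. (E satisfies the Sη rule.) -/
/-- With `E := S(K(SKK))`: if `tu ⊥ π` then `Et ⊥ u·π` (the Sη rule). -/
theorem E_Seta {Lam Stk : Type*} (A : AKS Lam Stk)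
    (t u : Lam) (π : Stk) (h : A.perp (A.app t u) π) :
    A.perp (A.app (A.app A.S (A.app A.K (A.app (A.app A.S A.K) A.K))) t)
      (A.push u π) := by
  have I_perp : A.perp (A.app (A.app A.S A.K) A.K) (A.push (A.app t u) π) :=
    A.S1 (A.S1 (A.S3 (A.S1 (A.S1 (A.S2 h _)))))
  exact A.S1 (A.S1 (A.S3 (A.S1 (A.S1 (A.S1 (A.S2 I_perp u))))))
end

section
/- Let K be an abstract Krivine structure and let Ê ∈ Λ satisfy the Sη rule, i.e. for all t, s ∈ Λ and π ∈ Π, if ts ⊥ π then Êt ⊥ s·π. Then: (i) for all P, Q ∈ P_⊥(Π), P ◇ Q ⊆ (Ê(^⊥P))^⊥ ∘_⊥ Q, where Ê(^⊥P) = {Êt : t ∈ ^⊥P}; (ii) for all P ∈ P_⊥(Π), (Ê(^⊥P))^⊥ ⊆ (ÊÊ)^⊥ ∘_⊥ P. -/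
theorem AKS.leadsto_subset_circbot {Lam Stk : Type*} (A : AKS Lam Stk) (P Q : Set Stk) :
    A.leadsto (A.lpol Q) P ⊆ A.circbot P Q :=
  fun π hπ _ ht => ht π hπ

/-- If `Ê` satisfies the Sη rule, then (i) `P ◇ Q ⊆ (Ê(^⊥P))^⊥ ∘_⊥ Q` and
(ii) `(Ê(^⊥P))^⊥ ⊆ (ÊÊ)^⊥ ∘_⊥ P`. -/
theorem Seta_consequences {Lam Stk : Type*} (A : AKS Lam Stk)
    (Ehat : Lam)
    (hE : ∀ (t s : Lam) (π : Stk), A.perp (A.app t s) π →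
      A.perp (A.app Ehat t) (A.push s π)) :
    (∀ P Q : Set Stk, A.stable P → A.stable Q →
      A.diamond P Q ⊆
        A.circbot (A.pol {x | ∃ t ∈ A.lpol P, x = A.app Ehat t}) Q) ∧
    (∀ P : Set Stk, A.stable P →
      A.pol {x | ∃ t ∈ A.lpol P, x = A.app Ehat t} ⊆
        A.circbot (A.pol {A.app Ehat Ehat}) P) := by
  refine ⟨fun P Q _ _ π hπ => A.leadsto_subset_circbot _ _ ?_,
    fun P _ π hπ => A.leadsto_subset_circbot _ _ ?_⟩
  · rintro s hs _ ⟨t, ht, rfl⟩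
    exact hE t s π (hπ _ ⟨t, ht, s, hs, rfl⟩)
  · rintro t ht _ rfl
    exact hE Ehat t π (hπ _ ⟨t, ht, rfl⟩)
end

section
/- Let K be an abstract Krivine structure and set E := S(K(SKK)). For all P, Q, R ∈ P_⊥(Π): if R ⊆ P ∘_⊥ Q, then (Q ⇒_⊥ R) ⊆ (E(^⊥P))^⊥ ⊆ (EE)^⊥ ∘_⊥ P, where E(^⊥P) = {Et : t ∈ ^⊥P}. (Partial converse of the half adjunction property; EE is the adjunctor.) -/
namespace AKS

variable {Lam Stk : Type*} (A : AKS Lam Stk)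

/-- `SKK` behaves as the identity. -/
theorem skk_perp_push {t : Lam} {π : Stk} (h : A.perp t π) :
    A.perp (A.app (A.app A.S A.K) A.K) (A.push t π) :=
  A.S1 (A.S1 (A.S3 (A.S1 (A.S1 (A.S2 h _)))))

/-- `S(K(SKK))` reduces `t · u · π` to `tu` against `π`, here with the first argument applied. -/
theorem e_app_perp_push {t u : Lam} {π : Stk} (h : A.perp (A.app t u) π) :
    A.perp (A.app (A.app A.S (A.app A.K (A.app (A.app A.S A.K) A.K))) t) (A.push u π) :=
  A.S1 (A.S1 (A.S3 (A.S1 (A.S1 (A.S1 (A.S2 (A.skk_perp_push h) _))))))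

theorem subset_pol_lpol (P : Set Stk) : P ⊆ A.pol (A.lpol P) :=
  fun _ hπ _ ht => ht _ hπ

theorem app_mem_lpol_leadsto {P : Set Stk} {L : Set Lam} {t u : Lam} (ht : t ∈ A.lpol P)
    (hu : u ∈ L) : A.app t u ∈ A.lpol (A.leadsto L P) :=
  fun _ hπ => A.S1 (ht _ (hπ u hu))

end AKS

/-- Partial converse of the half adjunction property, with `E := S(K(SKK))`:
if `R ⊆ P ∘_⊥ Q` then `(Q ⇒_⊥ R) ⊆ (E(^⊥P))^⊥ ⊆ (EE)^⊥ ∘_⊥ P`. -/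
theorem adjunction_converse {Lam Stk : Type*} (A : AKS Lam Stk)
    (P Q R : Set Stk) (hP : A.stable P) (hQ : A.stable Q) (hR : A.stable R)
    (h : R ⊆ A.circbot P Q) :
    A.impbot Q R ⊆
      A.pol {x | ∃ t ∈ A.lpol P,
        x = A.app (A.app A.S (A.app A.K (A.app (A.app A.S A.K) A.K))) t} ∧
    A.pol {x | ∃ t ∈ A.lpol P,
        x = A.app (A.app A.S (A.app A.K (A.app (A.app A.S A.K) A.K))) t} ⊆
      A.circbot
        (A.pol {A.app (A.app A.S (A.app A.K (A.app (A.app A.S A.K) A.K)))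
          (A.app A.S (A.app A.K (A.app (A.app A.S A.K) A.K)))}) P := by
  constructor
  · rintro π hπ _ ⟨t, ht, rfl⟩
    refine hπ _ ?_
    rintro _ ⟨u, hu, ρ, hρ, rfl⟩
    exact A.e_app_perp_push (h hρ _ (A.app_mem_lpol_leadsto ht hu))
  · intro π hπ
    refine A.subset_pol_lpol _ fun t ht => ?_
    rintro _ rfl
    exact A.e_app_perp_push (hπ _ ⟨t, ht, rfl⟩)
end

section
/- Let (A, ≤, app, →, Φ, k, s, e) be an implicative ordered combinatory algebra. Suppose there are elements p₀, p₁ ∈ Φ and a binary pairing operation (a,b) ↦ a ∧ b on A such that: (i) p₀ (a ∧ b) ≤ a and p₁ (a ∧ b) ≤ b for all a, b ∈ A; (ii) there is an element P ∈ Φ with a ∧ b = P a b for all a, b; (iii) for every f ∈ Φ there is d ∈ Φ such that d ℓ ≤ f (p₀ ℓ) (p₁ ℓ) for all ℓ ∈ A. Then for all a, b, c ∈ A: a ∧ b ⊑ c if and only if a ⊑ (b → c). (Hence (A, ⊑, ∧, →) is a Heyting preorder.) -/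
/-- An implicative ordered combinatory algebra (IOCA) on an inf-complete
partial order (i.e. a complete lattice). -/
structure IOCA (A : Type*) [CompleteLattice A] where
  app : A → A → A
  imp : A → A → A
  Phi : Set A
  k : A
  s : A
  e : A
  k_mem : k ∈ Phi
  s_mem : s ∈ Phi
  e_mem : e ∈ Phi
  Phi_app : ∀ {a b}, a ∈ Phi → b ∈ Phi → app a b ∈ Phi
  app_mono : ∀ {a b c d}, a ≤ b → c ≤ d → app a c ≤ app b d
  imp_mono : ∀ {a b c d}, b ≤ a → c ≤ d → imp a c ≤ imp b d
  k_le : ∀ a b, app (app k a) b ≤ a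
  s_le : ∀ a b c, app (app (app s a) b) c ≤ app (app a c) (app b c)
  PA : ∀ {a b c}, a ≤ imp b c → app a b ≤ c
  PE : ∀ {a b c}, app a b ≤ c → app e a ≤ imp b c

namespace IOCA

variable {A : Type*} [CompleteLattice A] (M : IOCA A)

/-- The combinator `s (k f) g`, realizing the composition of `f` and `g`. -/
def comp (f g : A) : A := M.app (M.app M.s (M.app M.k f)) g

theorem comp_mem {f g : A} (hf : f ∈ M.Phi) (hg : g ∈ M.Phi) : M.comp f g ∈ M.Phi :=
  M.Phi_app (M.Phi_app M.s_mem (M.Phi_app M.k_mem hf)) hg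

theorem comp_app_le (f g x : A) : M.app (M.comp f g) x ≤ M.app f (M.app g x) :=
  (M.s_le _ _ _).trans (M.app_mono (M.k_le _ _) le_rfl)

/-- The combinator `s (k (s (k f))) g`, realizing `x y ↦ f (g x y)`. -/
def comp₂ (f g : A) : A := M.comp (M.app M.s (M.app M.k f)) g

theorem comp₂_mem {f g : A} (hf : f ∈ M.Phi) (hg : g ∈ M.Phi) : M.comp₂ f g ∈ M.Phi :=
  M.comp_mem (M.Phi_app M.s_mem (M.Phi_app M.k_mem hf)) hg

theorem comp₂_app_le (f g x y : A) :
    M.app (M.app (M.comp₂ f g) x) y ≤ M.app f (M.app (M.app g x) y) :=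
  (M.app_mono (M.comp_app_le _ _ _) le_rfl).trans (M.comp_app_le f (M.app g x) y)

end IOCA

/-- In an IOCA with pairing `∧` (given by a combinator `P ∈ Φ`), projections
`p₀, p₁ ∈ Φ` and the combinator construction `d` of `D(f)`:
`a ∧ b ⊑ c ↔ a ⊑ (b → c)`, so `(A, ⊑, ∧, →)` is a Heyting preorder. -/
theorem heyting_adjunction {A : Type*} [CompleteLattice A] (M : IOCA A)
    (p₀ p₁ : A) (hp₀ : p₀ ∈ M.Phi) (hp₁ : p₁ ∈ M.Phi)
    (wedge : A → A → A)
    (hproj₀ : ∀ a b : A, M.app p₀ (wedge a b) ≤ a)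
    (hproj₁ : ∀ a b : A, M.app p₁ (wedge a b) ≤ b)
    (Pc : A) (hPc : Pc ∈ M.Phi)
    (hpair : ∀ a b : A, wedge a b = M.app (M.app Pc a) b)
    (hD : ∀ f ∈ M.Phi, ∃ d ∈ M.Phi,
      ∀ ℓ : A, M.app d ℓ ≤ M.app (M.app f (M.app p₀ ℓ)) (M.app p₁ ℓ)) :
    ∀ a b c : A,
      (∃ f ∈ M.Phi, M.app f (wedge a b) ≤ c) ↔
      (∃ f ∈ M.Phi, M.app f a ≤ M.imp b c) := by
  intro a b c
  constructor
  · rintro ⟨f, hf, hfc⟩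
    rw [hpair] at hfc
    exact ⟨M.comp M.e (M.comp₂ f Pc), M.comp_mem M.e_mem (M.comp₂_mem hf hPc),
      (M.comp_app_le _ _ _).trans (M.PE ((M.comp₂_app_le f Pc a b).trans hfc))⟩
  · rintro ⟨f, hf, hfc⟩
    obtain ⟨d, hd, hdf⟩ := hD f hf
    exact ⟨d, hd, (hdf _).trans ((M.app_mono (M.app_mono le_rfl (hproj₀ a b))
      (hproj₁ a b)).trans (M.PA hfc))⟩
end

section
/- Let (A, ≤) be an inf-complete partially ordered set with a map → : A × A → A antitone in the first and monotone in the second argument, and let Φ ⊆ A. Define: a b := inf{c : a ≤ b → c}; k := inf{a → (b → a) : a, b ∈ A}; s := inf{a → (b → (c → (a c)(b c))) : a, b, c ∈ A}; e := inf{a → (b → a b) : a, b ∈ A}; c := inf{((a → b) → a) → a : a, b ∈ A}. If Φ is closed under the application (a,b) ↦ ab and k, s, e, c ∈ Φ, then (A, ≤, app, →, Φ, k, s, e, c) is a Krivine ordered combinatory algebra; i.e.: the application is monotone in both arguments; a ≤ b → c implies a b ≤ c; k a b ≤ a; s a b c ≤ (a c)(b c); a b ≤ c implies e a ≤ b → c;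 and c ≤ ((a → b) → a) → a, for all a, b, c ∈ A. -/
variable {A : Type*} [CompleteLattice A]

/-- The application `a b := inf {c : a ≤ b → c}` induced by an implication. -/
def kapp (imp : A → A → A) (a b : A) : A := sInf {c | a ≤ imp b c}

/-- `k := inf {a → (b → a)}`. -/
def kK (imp : A → A → A) : A := sInf {x | ∃ a b : A, x = imp a (imp b a)}

/-- `s := inf {a → (b → (c → (a c)(b c)))}`. -/
def kS (imp : A → A → A) : A :=
  sInf {x | ∃ a b c : A, x = imp a (imp b (imp c (kapp imp (kapp imp a c) (kapp imp b c))))}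

/-- `e := inf {a → (b → a b)}`. -/
def kE (imp : A → A → A) : A := sInf {x | ∃ a b : A, x = imp a (imp b (kapp imp a b))}

/-- `c := inf {((a → b) → a) → a}`. -/
def kC (imp : A → A → A) : A := sInf {x | ∃ a b : A, x = imp (imp (imp a b) a) a}

/-- Half of the adjunction between application and implication. -/
theorem kapp_le_of_le_imp {imp : A → A → A} {a b c : A} (h : a ≤ imp b c) :
    kapp imp a b ≤ c :=
  sInf_le h

/-- Application is monotone in both arguments when implication is antitone in its
first argument. -/
theorem kapp_le_kapp {imp : A → A → A}
    (imp_anti : ∀ c : A, Antitone fun b => imp b c)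
    {a b c d : A} (hab : a ≤ b) (hcd : c ≤ d) : kapp imp a c ≤ kapp imp b d :=
  sInf_le_sInf fun _ hx => (hab.trans hx).trans (imp_anti _ hcd)

/-- If `(A, ≤, →, Φ)` is proper (i.e. `Φ` is closed under the induced
application and contains `k, s, e, c`), then the resulting structure is a
Krivine ordered combinatory algebra. -/
theorem proper_gives_KOCA (imp : A → A → A)
    (imp_mono : ∀ {a b c d : A}, b ≤ a → c ≤ d → imp a c ≤ imp b d)
    (Phi : Set A)
    (Phi_app : ∀ a ∈ Phi, ∀ b ∈ Phi, kapp imp a b ∈ Phi)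
    (hk : kK imp ∈ Phi) (hs : kS imp ∈ Phi) (he : kE imp ∈ Phi)
    (hc : kC imp ∈ Phi) :
    (∀ a b c d : A, a ≤ b → c ≤ d → kapp imp a c ≤ kapp imp b d) ∧
    (∀ a b c : A, a ≤ imp b c → kapp imp a b ≤ c) ∧
    (∀ a b : A, kapp imp (kapp imp (kK imp) a) b ≤ a) ∧
    (∀ a b c : A,
      kapp imp (kapp imp (kapp imp (kS imp) a) b) c ≤
        kapp imp (kapp imp a c) (kapp imp b c)) ∧
    (∀ a b c : A, kapp imp a b ≤ c → kapp imp (kE imp) a ≤ imp b c) ∧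
    (∀ a b : A, kC imp ≤ imp (imp (imp a b) a) a) := by
  refine ⟨fun _ _ _ _ hab hcd =>
      kapp_le_kapp (imp := imp) (fun _ _ _ h => imp_mono h le_rfl) hab hcd,
    fun _ _ _ => kapp_le_of_le_imp, fun a b => ?_, fun a b c => ?_,
    fun a b c h => ?_, fun a b => sInf_le ⟨a, b, rfl⟩⟩
  · exact kapp_le_of_le_imp (kapp_le_of_le_imp (sInf_le ⟨a, b, rfl⟩))
  · exact kapp_le_of_le_imp (kapp_le_of_le_imp (kapp_le_of_le_imp (sInf_le ⟨a, b, c, rfl⟩)))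
  · have he_le : kE imp ≤ imp a (imp b (kapp imp a b)) := sInf_le ⟨a, b, rfl⟩
    exact (kapp_le_of_le_imp he_le).trans (imp_mono le_rfl h)
end
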